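/- Let G be a connected graph, let PV(G) be the set of pendant (degree-one) vertices of G, and let H = G − PV(G). Suppose H is connected, every vertex of PV(G) has its neighbor in H, and there is a proper-path coloring c of H using at most 3 colors such that H has the strong property under c. Then pc(G) ≤ max{3, |PV(G)|}. -/

import Mathlib

/-- A walk in an edge-colored graph is *proper* if no two consecutive edges share a color. -/
def ProperWalk {V : Type*} {G : SimpleGraph V} (c : Sym2 V → ℕ) {u v : V}
    (p : G.Walk u v) : Prop :=
  p.edges.Chain' fun e f => c e ≠ c f

/-- `c` is a proper-path coloring of `G`: every pair of distinct vertices is joined by a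
proper path. -/
def IsProperPathColoring {V : Type*} (G : SimpleGraph V) (c : Sym2 V → ℕ) : Prop :=
  ∀ u v : V, u ≠ v → ∃ p : G.Walk u v, p.IsPath ∧ ProperWalk c p

/-- The proper connection number: the least `k` such that some coloring of the edges with
colors `0, …, k-1` is a proper-path coloring. -/
noncomputable def pc {V : Type*} (G : SimpleGraph V) : ℕ :=
  sInf {k | ∃ c : Sym2 V → ℕ, (∀ e ∈ G.edgeSet, c e < k) ∧ IsProperPathColoring G c}

/-- `G` has the strong property under `c`: any two distinct vertices are joined by two proper
paths whose first-edge colors differ and whose last-edge colors differ. -/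
def HasStrongProperty {V : Type*} (G : SimpleGraph V) (c : Sym2 V → ℕ) : Prop :=
  ∀ u v : V, u ≠ v → ∃ p q : G.Walk u v, p.IsPath ∧ q.IsPath ∧
    ProperWalk c p ∧ ProperWalk c q ∧
    p.edges.head?.map c ≠ q.edges.head?.map c ∧
    p.edges.getLast?.map c ≠ q.edges.getLast?.map c

/-- `c` makes `G` 2-proper connected: any two distinct vertices are joined by two
internally vertex-disjoint proper paths. -/
def Is2ProperConnected {V : Type*} (G : SimpleGraph V) (c : Sym2 V → ℕ) : Prop :=
  ∀ u v : V, u ≠ v → ∃ p q : G.Walk u v, p.IsPath ∧ q.IsPath ∧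
    ProperWalk c p ∧ ProperWalk c q ∧ p ≠ q ∧
    ∀ x, x ∈ p.support → x ∈ q.support → x = u ∨ x = v

/-- The 2-proper connection number. -/
noncomputable def pc2 {V : Type*} (G : SimpleGraph V) : ℕ :=
  sInf {k | ∃ c : Sym2 V → ℕ, (∀ e ∈ G.edgeSet, c e < k) ∧ Is2ProperConnected G c}

def GoodX {W : Type*} (H : SimpleGraph W) (c : Sym2 W → ℕ) (x y : W) (a b : ℕ) : Prop :=
  (x = y → a ≠ b) ∧ (x ≠ y → ∃ p : H.Walk x y, p.IsPath ∧ ProperWalk c p ∧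
    p.edges.head?.map c ≠ some a ∧ p.edges.getLast?.map c ≠ some b)

theorem proper_rev {V : Type*} {G : SimpleGraph V} (c : Sym2 V → ℕ) {u v : V}
    (p : G.Walk u v) (h : ProperWalk c p) : ProperWalk c p.reverse := by
  unfold ProperWalk at *
  rw [SimpleGraph.Walk.edges_reverse]
  change List.IsChain _ _
  rw [List.isChain_reverse]
  exact List.IsChain.imp (fun a b hab => hab.symm) h

theorem GoodX.symm {W : Type*} {H : SimpleGraph W} {c : Sym2 W → ℕ} {x y : W} {a b : ℕ}
    (h : GoodX H c x y a b) : GoodX H c y x b a := by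
  refine ⟨fun e => (h.1 e.symm).symm, fun e => ?_⟩
  obtain ⟨p, h1, h2, h3, h4⟩ := h.2 e.symm
  refine ⟨p.reverse, h1.reverse, proper_rev c p h2, ?_, ?_⟩
  · simpa using h4
  · simpa using h3

theorem good_of_strong {W : Type*} {H : SimpleGraph W} {c : Sym2 W → ℕ}
    (hs : HasStrongProperty H c) {x y : W} (hxy : x ≠ y) :
    ∃ s1 s2 t1 t2 : Option ℕ, ∀ a b : ℕ,
      ¬ ((s1 = some a ∧ t2 = some b) ∨ (s2 = some a ∧ t1 = some b)) → GoodX H c x y a b := by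
  obtain ⟨p, q, hp, hq, pp, pq, h1, h2⟩ := hs x y hxy
  refine ⟨p.edges.head?.map c, q.edges.head?.map c, p.edges.getLast?.map c,
    q.edges.getLast?.map c, fun a b hab => ⟨fun e => absurd e hxy, fun _ => ?_⟩⟩
  by_cases h : p.edges.head?.map c ≠ some a ∧ p.edges.getLast?.map c ≠ some b
  · exact ⟨p, hp, pp, h⟩
  · refine ⟨q, hq, pq, ?_⟩
    grind

theorem edge_lt {W : Type*} {H : SimpleGraph W} {c : Sym2 W → ℕ}
    (hc3 : ∀ e ∈ H.edgeSet, c e < 3) {x y : W} (p : H.Walk x y) (a : ℕ) (ha : 3 ≤ a) :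
    p.edges.head?.map c ≠ some a ∧ p.edges.getLast?.map c ≠ some a := by
  constructor
  · intro h
    rw [Option.map_eq_some_iff] at h
    obtain ⟨e, he, rfl⟩ := h
    have := hc3 e (p.edges_subset_edgeSet (List.mem_of_head? he))
    omega
  · intro h
    rw [Option.map_eq_some_iff] at h
    obtain ⟨e, he, rfl⟩ := h
    have := hc3 e (p.edges_subset_edgeSet (List.mem_of_getLast? he))
    omega

theorem good_big {W : Type*} {H : SimpleGraph W} {c : Sym2 W → ℕ}
    (hc3 : ∀ e ∈ H.edgeSet, c e < 3)
    (hs : HasStrongProperty H c) (x y : W) (a b : ℕ) (hab : a ≠ b) (ha : 3 ≤ a) :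
    GoodX H c x y a b := by
  refine ⟨fun _ => hab, fun hxy => ?_⟩
  obtain ⟨p, q, hp, hq, pp, pq, h1, h2⟩ := hs x y hxy
  by_cases h : p.edges.getLast?.map c ≠ some b
  · exact ⟨p, hp, pp, (edge_lt hc3 p a ha).1, h⟩
  · refine ⟨q, hq, pq, (edge_lt hc3 q a ha).1, ?_⟩
    grind

theorem exists_bad {W : Type*} {H : SimpleGraph W} {c : Sym2 W → ℕ}
    (hs : HasStrongProperty H c) (x y : W) :
    ∃ B : Finset (Fin 3 × Fin 3), (B.card ≤ 3) ∧ (x ≠ y → B.card ≤ 2) ∧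
      ∀ a b : Fin 3, (a, b) ∉ B → GoodX H c x y a b := by
  classical
  by_cases hxy : x = y
  · refine ⟨Finset.univ.filter (fun p => p.1 = p.2), by decide, fun h => absurd hxy h, ?_⟩
    intro a b hab
    refine ⟨fun _ h => hab ?_, fun h => absurd hxy h⟩
    simpa using Fin.ext h
  · obtain ⟨s1, s2, t1, t2, h⟩ := good_of_strong hs hxy
    have key : ∀ s t : Option ℕ, (Finset.univ.filter (fun p : Fin 3 × Fin 3 =>
        s = some (p.1 : ℕ) ∧ t = some (p.2 : ℕ))).card ≤ 1 := by
      intro s t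
      rw [Finset.card_le_one]
      rintro ⟨a, b⟩ h1 ⟨a', b'⟩ h2
      simp only [Finset.mem_filter, Finset.mem_univ, true_and] at h1 h2
      obtain ⟨h1, h3⟩ := h1
      obtain ⟨h2, h4⟩ := h2
      rw [h1] at h2
      rw [h3] at h4
      simp only [Option.some.injEq] at h2 h4
      exact Prod.ext (Fin.ext h2) (Fin.ext h4)
    have k2 := (Finset.card_union_le _ _).trans (Nat.add_le_add (key s1 t2) (key s2 t1))
    refine ⟨_, k2.trans (by norm_num), fun _ => k2, ?_⟩
    intro a b hab
    apply h
    simpa using hab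

theorem count_lemma (B1 B2 B3 : Finset (Fin 3 × Fin 3)) (h : B1.card + B2.card + B3.card ≤ 8) :
    ∃ a b d : Fin 3, (a, b) ∉ B1 ∧ (a, d) ∉ B2 ∧ (b, d) ∉ B3 := by
  classical
  by_contra hcon
  push Not at hcon
  have hsub : (Finset.univ : Finset ((Fin 3 × Fin 3) × Fin 3)) ⊆
      ((B1 ×ˢ (Finset.univ : Finset (Fin 3))).image (fun z => (z.1, z.2))) ∪
      ((B2 ×ˢ (Finset.univ : Finset (Fin 3))).image (fun z => ((z.1.1, z.2), z.1.2))) ∪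
      ((B3 ×ˢ (Finset.univ : Finset (Fin 3))).image (fun z => ((z.2, z.1.1), z.1.2))) := by
    rintro ⟨⟨a, b⟩, d⟩ -
    have := hcon a b d
    simp only [Finset.mem_union, Finset.mem_image, Finset.mem_product]
    by_cases h1 : (a, b) ∈ B1
    · exact Or.inl (Or.inl ⟨((a, b), d), by simp [h1], rfl⟩)
    by_cases h2 : (a, d) ∈ B2
    · exact Or.inl (Or.inr ⟨((a, d), b), by simp [h2], rfl⟩)
    · exact Or.inr ⟨((b, d), a), by simp [this h1 h2], rfl⟩
  have h1 := Finset.card_le_card hsub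
  have h2 := Finset.card_union_le
    (((B1 ×ˢ (Finset.univ : Finset (Fin 3))).image (fun z => (z.1, z.2))) ∪
      ((B2 ×ˢ (Finset.univ : Finset (Fin 3))).image (fun z => ((z.1.1, z.2), z.1.2))))
    ((B3 ×ˢ (Finset.univ : Finset (Fin 3))).image (fun z => ((z.2, z.1.1), z.1.2)))
  have h3 := Finset.card_union_le
    (((B1 ×ˢ (Finset.univ : Finset (Fin 3))).image (fun z => (z.1, z.2))))
      ((B2 ×ˢ (Finset.univ : Finset (Fin 3))).image (fun z => ((z.1.1, z.2), z.1.2)))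
  have h4 := Finset.card_image_le (s := B1 ×ˢ (Finset.univ : Finset (Fin 3)))
    (f := fun z => (z.1, z.2))
  have h5 := Finset.card_image_le (s := B2 ×ˢ (Finset.univ : Finset (Fin 3)))
    (f := fun z => ((z.1.1, z.2), z.1.2))
  have h6 := Finset.card_image_le (s := B3 ×ˢ (Finset.univ : Finset (Fin 3)))
    (f := fun z => ((z.2, z.1.1), z.1.2))
  simp only [Finset.card_product, Finset.card_univ, Fintype.card_prod, Fintype.card_fin]
    at h1 h2 h3 h4 h5 h6
  omega

theorem choose_three {W : Type*} {H : SimpleGraph W} {c : Sym2 W → ℕ}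
    (hs : HasStrongProperty H c) (h : ℕ → W) :
    ∃ g : ℕ → ℕ, (∀ i, g i < 3) ∧
      ∀ i j, i < 3 → j < 3 → i ≠ j → GoodX H c (h i) (h j) (g i) (g j) := by
  have main : ∃ a b d : ℕ, a < 3 ∧ b < 3 ∧ d < 3 ∧ GoodX H c (h 0) (h 1) a b ∧
      GoodX H c (h 0) (h 2) a d ∧ GoodX H c (h 1) (h 2) b d := by
    by_cases hall : h 0 = h 1 ∧ h 0 = h 2
    · refine ⟨0, 1, 2, by norm_num, by norm_num, by norm_num, ?_, ?_, ?_⟩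
      · exact ⟨fun _ => by norm_num, fun e => absurd hall.1 e⟩
      · exact ⟨fun _ => by norm_num, fun e => absurd hall.2 e⟩
      · exact ⟨fun _ => by norm_num, fun e => absurd (hall.1.symm.trans hall.2) e⟩
    · obtain ⟨B1, b1, c1, d1⟩ := exists_bad hs (h 0) (h 1)
      obtain ⟨B2, b2, c2, d2⟩ := exists_bad hs (h 0) (h 2)
      obtain ⟨B3, b3, c3, d3⟩ := exists_bad hs (h 1) (h 2)
      have : B1.card + B2.card + B3.card ≤ 8 := by
        by_cases e1 : h 0 = h 1
        · have e2 : h 0 ≠ h 2 := fun e => hall ⟨e1, e⟩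
          have e3 : h 1 ≠ h 2 := e1 ▸ e2
          have := c2 e2
          have := c3 e3
          omega
        · have := c1 e1
          by_cases e2 : h 0 = h 2
          · have e3 : h 1 ≠ h 2 := fun e => e1 (e2.trans e.symm)
            have := c3 e3
            omega
          · have := c2 e2
            omega
      obtain ⟨a, b, d, k1, k2, k3⟩ := count_lemma B1 B2 B3 this
      exact ⟨a, b, d, a.2, b.2, d.2, d1 _ _ k1, d2 _ _ k2, d3 _ _ k3⟩
  obtain ⟨a, b, d, ha, hb, hd, g1, g2, g3⟩ := main
  refine ⟨fun i => if i = 0 then a else if i = 1 then b else d, ?_, ?_⟩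
  · intro i
    dsimp only
    split_ifs <;> assumption
  · intro i j hi hj hij
    interval_cases i <;> interval_cases j <;> simp at hij ⊢ <;>
      first | assumption | (apply GoodX.symm; assumption)

theorem ext_walk {V : Type*} {G : SimpleGraph V} (c : Sym2 V → ℕ) {u x y : V}
    (hu : G.Adj u x) (p : G.Walk x y) (hp : p.IsPath) (pp : ProperWalk c p)
    (hns : u ∉ p.support) (hh : p.edges.head?.map c ≠ some (c s(u, x))) :
    (SimpleGraph.Walk.cons hu p).IsPath ∧ ProperWalk c (SimpleGraph.Walk.cons hu p) := by
  refine ⟨hp.cons hns, ?_⟩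
  unfold ProperWalk at *
  rw [SimpleGraph.Walk.edges_cons]
  change List.IsChain _ _
  rw [List.isChain_cons]
  refine ⟨?_, pp⟩
  intro e he h
  apply hh
  rw [Option.mem_def] at he
  rw [he, h]
  rfl

theorem stmt4 {V : Type*} [Fintype V] [DecidableEq V] (G : SimpleGraph V)
    [DecidableRel G.Adj] (hconn : G.Connected)
    (PV : Set V) (hPV : PV = {v : V | G.degree v = 1})
    (hHconn : (G.induce PVᶜ).Connected)
    (hnbr : ∀ v ∈ PV, ∀ w : V, G.Adj v w → w ∈ PVᶜ)
    (c : Sym2 ↥(PVᶜ) → ℕ)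
    (hc3 : ∀ e ∈ (G.induce PVᶜ).edgeSet, c e < 3)
    (hcpc : IsProperPathColoring (G.induce PVᶜ) c)
    (hstrong : HasStrongProperty (G.induce PVᶜ) c) :
    pc G ≤ max 3 PV.ncard := by
  classical
  obtain ⟨h0⟩ := hHconn.nonempty
  have hanch : ∀ u : V, ∃ w : ↥(PVᶜ), u ∈ PV → G.Adj u w := by
    intro u
    by_cases hu : u ∈ PV
    · have h1 : G.degree u = 1 := by rw [hPV] at hu; exact hu
      have h2 : 0 < G.degree u := by omega
      rw [SimpleGraph.degree_pos_iff_exists_adj] at h2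
      obtain ⟨w, hw⟩ := h2
      exact ⟨⟨w, hnbr u hu w hw⟩, fun _ => hw⟩
    · exact ⟨h0, fun h => absurd h hu⟩
  choose anch hanch using hanch
  obtain ⟨e, he_lt, he_inj⟩ : ∃ e : V → ℕ, (∀ u ∈ PV, e u < PV.ncard) ∧ Set.InjOn e PV := by
    have hcard : Nat.card PV = PV.ncard := rfl
    let E := Finite.equivFin PV
    refine ⟨fun u => if hu : u ∈ PV then (E ⟨u, hu⟩ : ℕ) else 0, ?_, ?_⟩
    · intro u hu
      simp only [hu, dite_true]
      exact (E ⟨u, hu⟩).2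
    · intro u hu v hv h
      simp only [hu, hv, dite_true] at h
      have := E.injective (Fin.ext h)
      simpa using this
  let hh : ℕ → ↥(PVᶜ) := fun i => if h : ∃ u ∈ PV, e u = i then anch h.choose else h0
  have hhe : ∀ u ∈ PV, hh (e u) = anch u := by
    intro u hu
    have h : ∃ u' ∈ PV, e u' = e u := ⟨u, hu, rfl⟩
    simp only [hh, h, dite_true]
    rw [he_inj h.choose_spec.1 hu h.choose_spec.2]
  obtain ⟨g, hg3, hg⟩ := choose_three hstrong hh
  let col : V → ℕ := fun u => if e u < 3 then g (e u) else e u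
  have hgood : ∀ u ∈ PV, ∀ v ∈ PV, u ≠ v →
      GoodX (G.induce PVᶜ) c (anch u) (anch v) (col u) (col v) := by
    intro u hu v hv huv
    have hne : e u ≠ e v := fun h => huv (he_inj hu hv h)
    by_cases h1 : e u < 3
    · by_cases h2 : e v < 3
      · have := hg _ _ h1 h2 hne
        rw [hhe u hu, hhe v hv] at this
        simpa only [col, h1, h2, if_true] using this
      · have := hg3 (e u)
        apply GoodX.symm
        apply good_big hc3 hstrong <;> simp only [col, h1, h2, if_true, if_false] <;> omega
    · have := hg3 (e v)
      apply good_big hc3 hstrong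
      · simp only [col, h1, if_false]
        split_ifs <;> omega
      · simp only [col, h1, if_false]
        omega
  have hcol : ∀ u ∈ PV, col u < max 3 PV.ncard := by
    intro u hu
    have := he_lt u hu
    have := hg3 (e u)
    simp only [col]
    split_ifs
    · exact lt_max_of_lt_left this
    · exact lt_max_of_lt_right (he_lt u hu)
  let c' : Sym2 V → ℕ := fun z =>
    if h : ∃ z0 : Sym2 ↥(PVᶜ), z0.map Subtype.val = z then c h.choose
    else if h : ∃ u ∈ PV, u ∈ z then col h.choose else 0
  have hc'1 : ∀ z0 : Sym2 ↥(PVᶜ), c' (z0.map Subtype.val) = c z0 := by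
    intro z0
    have h : ∃ z1 : Sym2 ↥(PVᶜ), z1.map Subtype.val = z0.map Subtype.val := ⟨z0, rfl⟩
    simp only [c', h, dite_true]
    congr 1
    exact Sym2.map.injective Subtype.val_injective h.choose_spec
  have hc'2 : ∀ u ∈ PV, ∀ w ∈ PVᶜ, c' s(u, w) = col u := by
    intro u hu w hw
    have h : ¬ ∃ z1 : Sym2 ↥(PVᶜ), z1.map Subtype.val = s(u, w) := by
      rintro ⟨z1, hz⟩
      have : u ∈ z1.map Subtype.val := by rw [hz]; simp
      rw [Sym2.mem_map] at this
      obtain ⟨a, -, rfl⟩ := this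
      exact a.2 hu
    have h' : ∃ u' ∈ PV, u' ∈ s(u, w) := ⟨u, hu, by simp⟩
    simp only [c', h, h', dite_true, dite_false]
    congr 1
    have h3 := h'.choose_spec
    rcases Sym2.mem_iff.1 h3.2 with h4 | h4
    · exact h4
    · exact absurd (h4 ▸ h3.1) hw
  clear_value c' col hh
  -- lifting
  have lift : ∀ (x y : ↥(PVᶜ)) (p : (G.induce PVᶜ).Walk x y), p.IsPath → ProperWalk c p →
      ∃ q : G.Walk x y, q.IsPath ∧ ProperWalk c' q ∧ (∀ z ∈ q.support, z ∈ PVᶜ) ∧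
        q.edges.head?.map c' = p.edges.head?.map c ∧
        q.edges.getLast?.map c' = p.edges.getLast?.map c := by
    intro x y p hp pp
    have hcomp : c' ∘ Sym2.map Subtype.val = c := funext hc'1
    obtain ⟨q, hq1, hq2, hq3⟩ : ∃ q : G.Walk (x : V) (y : V), q.IsPath ∧
        q.edges = p.edges.map (Sym2.map Subtype.val) ∧
        q.support = p.support.map Subtype.val :=
      ⟨p.map (SimpleGraph.Embedding.induce PVᶜ).toHom,
        SimpleGraph.Walk.IsPath.map Subtype.val_injective hp,
        SimpleGraph.Walk.edges_map _ _, SimpleGraph.Walk.support_map _ _⟩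
    refine ⟨q, hq1, ?_, ?_, ?_, ?_⟩
    · unfold ProperWalk at *
      rw [hq2]
      change List.IsChain _ _
      rw [List.isChain_map]
      refine List.IsChain.imp ?_ pp
      intro a b hab
      rw [hc'1, hc'1]
      exact hab
    · intro z hz
      rw [hq3, List.mem_map] at hz
      obtain ⟨a, -, rfl⟩ := hz
      exact a.2
    · rw [hq2, List.head?_map, Option.map_map, hcomp]
    · rw [hq2, List.getLast?_map, Option.map_map, hcomp]
  have mixed : ∀ u ∈ PV, ∀ v ∈ PVᶜ, ∃ p : G.Walk u v, p.IsPath ∧ ProperWalk c' p := by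
    intro u hu v hv
    have hadj := hanch u hu
    have hcu := hc'2 u hu _ (anch u).2
    by_cases hx : anch u = ⟨v, hv⟩
    · have hxv : (anch u : V) = v := congrArg Subtype.val hx
      rw [hxv] at hadj
      refine ⟨_, ext_walk c' hadj SimpleGraph.Walk.nil (by simp) List.isChain_nil ?_ (by simp)⟩
      simpa using hadj.ne
    · have : GoodX (G.induce PVᶜ) c (anch u) ⟨v, hv⟩ (col u) (col u + 3) :=
        (good_big hc3 hstrong _ _ _ _ (by omega) (by omega)).symm
      obtain ⟨p, hp, pp, h1, -⟩ := this.2 hx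
      obtain ⟨q, hq, pq, hs, h3, -⟩ := lift _ _ p hp pp
      refine ⟨_, ext_walk c' hadj q hq pq (fun h => hs u h hu) ?_⟩
      rw [h3, hcu]
      exact h1
  apply Nat.sInf_le
  refine ⟨c', ?_, ?_⟩
  · intro z
    induction z using Sym2.ind with
    | _ a b =>
    intro hab
    rw [SimpleGraph.mem_edgeSet] at hab
    by_cases ha : a ∈ PV
    · rw [hc'2 a ha b (hnbr a ha b hab)]
      exact hcol a ha
    · by_cases hb : b ∈ PV
      · rw [Sym2.eq_swap, hc'2 b hb a ha]
        exact hcol b hb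
      · have h1 := hc'1 s(⟨a, ha⟩, ⟨b, hb⟩)
        rw [Sym2.map_mk] at h1
        have h2 := hc3 s(⟨a, ha⟩, ⟨b, hb⟩) (by simpa using hab)
        change c' s(a, b) = _ at h1
        rw [h1]
        exact lt_max_of_lt_left h2
  · intro u v huv
    by_cases hu : u ∈ PV
    · by_cases hv : v ∈ PV
      · have hgd := hgood u hu v hv huv
        have au := hanch u hu
        have av := hanch v hv
        have hcu := hc'2 u hu _ (anch u).2
        have hcv := hc'2 v hv _ (anch v).2
        by_cases hx : anch u = anch v
        · have hne := hgd.1 hx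
          rw [← hx] at av hcv
          obtain ⟨w1, w2⟩ := ext_walk c' av.symm SimpleGraph.Walk.nil (by simp)
            List.isChain_nil (by simpa using av.ne') (by simp)
          refine ⟨_, ext_walk c' au _ w1 w2 ?_ ?_⟩
          · simp only [SimpleGraph.Walk.support_cons, SimpleGraph.Walk.support_nil,
              List.mem_cons, List.not_mem_nil, or_false, not_or]
            exact ⟨au.ne, huv⟩
          · rw [hcu, SimpleGraph.Walk.edges_cons, List.head?_cons, Option.map_some, Sym2.eq_swap,
              hcv]
            simpa using hne.symm
        · obtain ⟨p, hp, pp, h1, h2⟩ := hgd.2 hx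
          obtain ⟨q, hq, pq, hs, h3, h4⟩ := lift _ _ p hp pp
          obtain ⟨w1, w2⟩ := ext_walk c' au q hq pq (fun h => hs u h hu)
            (by rw [h3, hcu]; exact h1)
          obtain ⟨r1, r2⟩ := ext_walk c' av _ w1.reverse (proper_rev c' _ w2) (by
            simp only [SimpleGraph.Walk.support_reverse, SimpleGraph.Walk.support_cons,
              List.mem_reverse, List.mem_cons, not_or]
            exact ⟨huv.symm, fun h => hs v h hv⟩) (by
            have hqe : q.edges ≠ [] := by
              intro h
              apply hx
              have : q.length = 0 := by rw [← SimpleGraph.Walk.length_edges, h]; rfl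
              exact Subtype.ext (SimpleGraph.Walk.eq_of_length_eq_zero this)
            rw [SimpleGraph.Walk.edges_reverse, List.head?_reverse, SimpleGraph.Walk.edges_cons,
              List.getLast?_cons_of_ne_nil hqe, h4, hcv]
            exact h2)
          exact ⟨_, r1.reverse, proper_rev c' _ r2⟩
      · exact mixed u hu v hv
    · by_cases hv : v ∈ PV
      · obtain ⟨p, hp, pp⟩ := mixed v hv u hu
        exact ⟨p.reverse, hp.reverse, proper_rev c' p pp⟩
      · obtain ⟨p, hp, pp⟩ := hcpc ⟨u, hu⟩ ⟨v, hv⟩ (fun h => huv (congrArg Subtype.val h))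
        obtain ⟨q, hq, pq, -⟩ := lift _ _ p hp pp
        exact ⟨q, hq, pq⟩
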